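/- arXiv:2011.12718 — 11 statements merged into one kernel-verified Lean document; each statement's English description precedes it below -/
import Mathlib

section
/- For all ε₁ > 0, ε₂ > 0, β > 0 and 0 < λ ≤ b*, setting C = max{b*/β, β^{−1/2}, λ, √β}, one has both μ₀⁻¹ ≤ C(ε₂ + √ε₁) and ε₁ μ₁ ≤ C(ε₂ + √ε₁); in particular max{μ₀⁻¹, ε₁ μ₁} ≤ C(ε₂ + ε₁^{1/2}). -/
theorem aux_sqrt_bound (x e b : ℝ) (hx : 0 ≤ x) (he : 0 < e) (hb : 0 < b) :
    Real.sqrt (x ^ 2 + 4 * e * b) ≤ x + 2 * (Real.sqrt e * Real.sqrt b) := by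
  have h1 := Real.sq_sqrt he.le
  have h2 := Real.sq_sqrt hb.le
  have h3 : 0 ≤ Real.sqrt e * Real.sqrt b := by positivity
  apply Real.sqrt_le_iff.mpr
  refine ⟨by positivity, ?_⟩
  have h4 : (Real.sqrt e * Real.sqrt b) ^ 2 = e * b := by rw [mul_pow, h1, h2]
  nlinarith [mul_nonneg hx h3]

/-- For all ε₁ > 0, ε₂ > 0, β > 0 and 0 < λ ≤ b*, setting
C = max{b*/β, β^{−1/2}, λ, √β}, one has both μ₀⁻¹ ≤ C(ε₂ + √ε₁) and
ε₁ μ₁ ≤ C(ε₂ + √ε₁); in particular max{μ₀⁻¹, ε₁ μ₁} ≤ C(ε₂ + ε₁^{1/2}). -/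
theorem mu0_inv_and_eps1_mu1_bound (ε₁ ε₂ β lam bstar : ℝ)
    (hε₁ : 0 < ε₁) (hε₂ : 0 < ε₂) (hβ : 0 < β) (hlam : 0 < lam) (hlb : lam ≤ bstar) :
    let μ₀ : ℝ := (-ε₂ * bstar + Real.sqrt (ε₂ ^ 2 * bstar ^ 2 + 4 * ε₁ * β)) / (2 * ε₁)
    let μ₁ : ℝ := (ε₂ * lam + Real.sqrt (ε₂ ^ 2 * lam ^ 2 + 4 * ε₁ * β)) / (2 * ε₁)
    let C : ℝ := max (max (bstar / β) (β ^ (-(1 : ℝ) / 2))) (max lam (Real.sqrt β))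
    μ₀⁻¹ ≤ C * (ε₂ + Real.sqrt ε₁) ∧ ε₁ * μ₁ ≤ C * (ε₂ + Real.sqrt ε₁) ∧
      max μ₀⁻¹ (ε₁ * μ₁) ≤ C * (ε₂ + Real.sqrt ε₁) := by
  intro μ₀ μ₁ C
  have hb : 0 < bstar := lt_of_lt_of_le hlam hlb
  have hC1 : bstar / β ≤ C := le_max_of_le_left (le_max_left _ _)
  have hC2 : β ^ (-(1 : ℝ) / 2) ≤ C := le_max_of_le_left (le_max_right _ _)
  have hC3 : lam ≤ C := le_max_of_le_right (le_max_left _ _)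
  have hC4 : Real.sqrt β ≤ C := le_max_of_le_right (le_max_right _ _)
  have hsb : 0 < Real.sqrt β := Real.sqrt_pos.mpr hβ
  have hse : 0 < Real.sqrt ε₁ := Real.sqrt_pos.mpr hε₁
  have hr : β ^ (-(1 : ℝ) / 2) = Real.sqrt β / β := by
    rw [show (-(1 : ℝ) / 2) = 1 / 2 - 1 by norm_num, Real.rpow_sub hβ, Real.rpow_one,
      Real.sqrt_eq_rpow]
  rw [hr] at hC2
  have h0 : μ₀⁻¹ ≤ C * (ε₂ + Real.sqrt ε₁) := by
    have hk := aux_sqrt_bound (ε₂ * bstar) ε₁ β (by positivity) hε₁ hβ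
    rw [mul_pow] at hk
    have hs := Real.sq_sqrt (show 0 ≤ ε₂ ^ 2 * bstar ^ 2 + 4 * ε₁ * β by positivity)
    have hinv : μ₀⁻¹ = (ε₂ * bstar + Real.sqrt (ε₂ ^ 2 * bstar ^ 2 + 4 * ε₁ * β)) / (2 * β) := by
      apply inv_eq_of_mul_eq_one_left
      simp only [μ₀]
      rw [div_mul_div_comm, div_eq_one_iff_eq (by positivity)]
      linear_combination hs
    rw [hinv]
    calc _ ≤ (ε₂ * bstar + (ε₂ * bstar + 2 * (Real.sqrt ε₁ * Real.sqrt β))) / (2 * β) := by gcongr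
      _ = bstar / β * ε₂ + Real.sqrt β / β * Real.sqrt ε₁ := by field_simp; ring
      _ ≤ C * ε₂ + C * Real.sqrt ε₁ := by gcongr
      _ = _ := by ring
  have h1 : ε₁ * μ₁ ≤ C * (ε₂ + Real.sqrt ε₁) := by
    have hk := aux_sqrt_bound (ε₂ * lam) ε₁ β (by positivity) hε₁ hβ
    rw [mul_pow] at hk
    have he : ε₁ * μ₁ = (ε₂ * lam + Real.sqrt (ε₂ ^ 2 * lam ^ 2 + 4 * ε₁ * β)) / 2 := by
      simp only [μ₁]
      field_simp
    rw [he]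
    calc _ ≤ (ε₂ * lam + (ε₂ * lam + 2 * (Real.sqrt ε₁ * Real.sqrt β))) / 2 := by gcongr
      _ = lam * ε₂ + Real.sqrt β * Real.sqrt ε₁ := by ring
      _ ≤ C * ε₂ + C * Real.sqrt ε₁ := by gcongr
      _ = _ := by ring
  exact ⟨h0, h1, max_le h0 h1⟩
end

section
/- Let τ > 0, p ∈ (0,1), let N ≥ 8 be an integer divisible by 4, and let μ₀ ≥ N. Then the widths of the left graded part of the Bakhvalov-type x-mesh are nondecreasing, h_{x,0} ≤ h_{x,1} ≤ ⋯ ≤ h_{x,N/4−2}, and the first width satisfies h_{x,0} ≥ (7τ/(2p)) μ₀⁻¹ N⁻¹. -/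
/-- Let τ > 0, p ∈ (0,1), let N ≥ 8 be an integer divisible by 4, and let μ₀ ≥ N.
Then the widths of the left graded part of the Bakhvalov-type x-mesh,
x_i = (τ/(p μ₀)) · (−ln(1 − 4(1 − μ₀⁻¹) i/N)), are nondecreasing,
h_{x,0} ≤ h_{x,1} ≤ ⋯ ≤ h_{x,N/4−2}, and h_{x,0} ≥ (7τ/(2p)) μ₀⁻¹ N⁻¹. -/
theorem left_graded_mesh_widths (τ p μ₀ : ℝ) (N : ℕ)
    (hτ : 0 < τ) (hp0 : 0 < p) (hp1 : p < 1)
    (hN : 8 ≤ N) (hN4 : 4 ∣ N) (hμ : (N : ℝ) ≤ μ₀) :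
    let x : ℕ → ℝ := fun i =>
      (τ / (p * μ₀)) * (-Real.log (1 - 4 * (1 - μ₀⁻¹) * ((i : ℝ) / (N : ℝ))))
    let h : ℕ → ℝ := fun i => x (i + 1) - x i
    (∀ i j : ℕ, i ≤ j → j ≤ N / 4 - 2 → h i ≤ h j) ∧
      7 * τ / (2 * p) * μ₀⁻¹ * (N : ℝ)⁻¹ ≤ h 0 := by
  intro x h
  obtain ⟨k, rfl⟩ := hN4
  have hk : 2 ≤ k := by omega
  have hkR : (2 : ℝ) ≤ k := by exact_mod_cast hk
  push_cast at hμ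
  have hμ8 : (8 : ℝ) ≤ μ₀ := by linarith
  have hμ0 : 0 < μ₀ := by linarith
  have hinv0 : 0 < μ₀⁻¹ := inv_pos.mpr hμ0
  have hinv8 : μ₀⁻¹ ≤ 1 / 8 := by
    rw [← one_div]
    exact one_div_le_one_div_of_le (by norm_num) hμ8
  obtain ⟨a, ha⟩ : ∃ a : ℝ, a = (1 - μ₀⁻¹) / k := ⟨_, rfl⟩
  have hak : a * k = 1 - μ₀⁻¹ := by rw [ha]; field_simp
  have ha0 : 0 < a := by rw [ha]; apply div_pos <;> linarith
  have hC : 0 < τ / (p * μ₀) := by positivity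
  have hx : ∀ i : ℕ, x i = (τ / (p * μ₀)) * (-Real.log (1 - a * i)) := by
    intro i
    have : 4 * (1 - μ₀⁻¹) * ((i : ℝ) / ((4 * k : ℕ) : ℝ)) = a * i := by
      rw [ha]; push_cast; field_simp
    simp only [x, this]
  have hu : ∀ i : ℕ, i ≤ k → 0 < 1 - a * i := by
    intro i hi
    have : (i : ℝ) ≤ k := by exact_mod_cast hi
    have := mul_le_mul_of_nonneg_left this ha0.le
    linarith
  constructor
  · intro i j hij hj
    have hj' : j + 1 ≤ k := by omega
    simp only [h, hx]
    rw [← mul_sub, ← mul_sub]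
    apply mul_le_mul_of_nonneg_left _ hC.le
    have h1 := hu i (by omega)
    have h2 := hu (i + 1) (by omega)
    have h3 := hu j (by omega)
    have h4 := hu (j + 1) (by omega)
    have hijR : (i : ℝ) ≤ j := by exact_mod_cast hij
    have key : Real.log ((1 - a * i) * (1 - a * (j + 1 : ℕ))) ≤
        Real.log ((1 - a * j) * (1 - a * (i + 1 : ℕ))) := by
      apply Real.log_le_log (mul_pos h1 h4)
      push_cast
      nlinarith [mul_nonneg (mul_pos ha0 ha0).le (sub_nonneg.mpr hijR)]
    rw [Real.log_mul h1.ne' h4.ne', Real.log_mul h3.ne' h2.ne'] at key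
    linarith
  · have h1 := hu 1 (by omega)
    have hl := Real.log_le_sub_one_of_pos h1
    simp only [h, hx]
    rw [← mul_sub]
    have e : 7 * τ / (2 * p) * μ₀⁻¹ * ((4 * k : ℕ) : ℝ)⁻¹
        = (τ / (p * μ₀)) * ((7 / 8) / k) := by
      push_cast; field_simp; norm_num
    rw [e]
    apply mul_le_mul_of_nonneg_left _ hC.le
    have : (7 / 8) / (k : ℝ) ≤ a := by
      rw [ha]; gcongr; linarith
    simp at hl ⊢
    linarith
end

section
/- Let τ > 0, p ∈ (0,1), let N ≥ 8 be an integer divisible by 4, and let μ₀ ≥ N. Then the mesh width h_{x,N/4−2} of the Bakhvalov-type x-mesh satisfies (τ/(4p)) μ₀⁻¹ ≤ h_{x,N/4−2} ≤ (τ/p) μ₀⁻¹. -/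
/-- Let τ > 0, p ∈ (0,1), let N ≥ 8 be an integer divisible by 4, and let μ₀ ≥ N.
Then the mesh width h_{x,N/4−2} of the Bakhvalov-type x-mesh satisfies
(τ/(4p)) μ₀⁻¹ ≤ h_{x,N/4−2} ≤ (τ/p) μ₀⁻¹. -/
theorem penultimate_left_width_bounds (τ p μ₀ : ℝ) (N : ℕ)
    (hτ : 0 < τ) (hp0 : 0 < p) (hp1 : p < 1)
    (hN : 8 ≤ N) (hN4 : 4 ∣ N) (hμ : (N : ℝ) ≤ μ₀) :
    let x : ℕ → ℝ := fun i =>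
      (τ / (p * μ₀)) * (-Real.log (1 - 4 * (1 - μ₀⁻¹) * ((i : ℝ) / (N : ℝ))))
    let h : ℕ → ℝ := fun i => x (i + 1) - x i
    τ / (4 * p) * μ₀⁻¹ ≤ h (N / 4 - 2) ∧ h (N / 4 - 2) ≤ τ / p * μ₀⁻¹ := by
  obtain ⟨k, rfl⟩ := hN4
  obtain ⟨j, rfl⟩ : ∃ j, k = j + 2 := ⟨k - 2, by omega⟩
  intro x h
  have hidx : 4 * (j + 2) / 4 - 2 = j := by omega
  rw [hidx]
  have hj : (0 : ℝ) ≤ (j : ℝ) := Nat.cast_nonneg j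
  have hk : (0 : ℝ) < (j : ℝ) + 2 := by linarith
  push_cast at hμ
  have hμ0 : 0 < μ₀ := by linarith
  obtain ⟨m, hm⟩ : ∃ m, m = μ₀⁻¹ := ⟨_, rfl⟩
  have hm0 : 0 < m := by rw [hm]; positivity
  have hmμ : m * μ₀ = 1 := by rw [hm]; exact inv_mul_cancel₀ hμ0.ne'
  have hmj : m * (4 * ((j : ℝ) + 2)) ≤ 1 := by
    rw [← hmμ]; exact mul_le_mul_of_nonneg_left hμ hm0.le
  have hmj0 : 0 ≤ m * (j : ℝ) := by positivity
  have hA : 1 - 4 * (1 - μ₀⁻¹) * ((j : ℝ) / ((4 * (j + 2) : ℕ) : ℝ))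
      = (2 + m * j) / ((j : ℝ) + 2) := by
    rw [← hm]; push_cast; field_simp; ring
  have hB : 1 - 4 * (1 - μ₀⁻¹) * (((j + 1 : ℕ) : ℝ) / ((4 * (j + 2) : ℕ) : ℝ))
      = (1 + m * (j + 1)) / ((j : ℝ) + 2) := by
    rw [← hm]; push_cast; field_simp; ring
  have hAp : 0 < 2 + m * (j : ℝ) := by linarith
  have hBp : 0 < 1 + m * ((j : ℝ) + 1) := by nlinarith
  have hh : h j = τ / p * m * Real.log ((2 + m * j) / (1 + m * (j + 1))) := by
    simp only [h, x]
    rw [hA, hB, Real.log_div hAp.ne' hk.ne', Real.log_div hBp.ne' hk.ne',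
      Real.log_div hAp.ne' hBp.ne', hm]
    field_simp
    ring
  have hc : 0 < τ / p * m := by positivity
  have hr : 0 < (2 + m * (j : ℝ)) / (1 + m * (j + 1)) := by positivity
  rw [hh, ← hm]
  constructor
  · have h1 := Real.one_sub_inv_le_log_of_pos hr
    have h2 : ((2 + m * (j : ℝ)) / (1 + m * (j + 1)))⁻¹ ≤ 3 / 4 := by
      rw [inv_div, div_le_iff₀ hAp]; nlinarith
    have h3 := mul_le_mul_of_nonneg_left
      (show (1 / 4 : ℝ) ≤ Real.log ((2 + m * j) / (1 + m * (j + 1))) by linarith) hc.le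
    calc τ / (4 * p) * m = τ / p * m * (1 / 4) := by field_simp
      _ ≤ _ := h3
  · have h1 := Real.log_le_sub_one_of_pos hr
    have h2 : (2 + m * (j : ℝ)) / (1 + m * (j + 1)) ≤ 2 := by
      rw [div_le_iff₀ hBp]; nlinarith
    exact mul_le_of_le_one_right hc.le (by linarith)
end

section
/- Let τ > 0, p ∈ (0,1), let N ≥ 8 be an integer divisible by 4, and let μ₀ ≥ N. Then the mesh width h_{x,N/4−1} = σ_{x,0} − x_{N/4−1} = (τ/(p μ₀)) ln(1 + 4(μ₀ − 1)/N) of the Bakhvalov-type x-mesh satisfies (τ/(2p)) μ₀⁻¹ ≤ h_{x,N/4−1} ≤ (4τ/p) N⁻¹. -/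
/-- Let τ > 0, p ∈ (0,1), let N ≥ 8 be an integer divisible by 4, and let μ₀ ≥ N.
Then the mesh width h_{x,N/4−1} = σ_{x,0} − x_{N/4−1} = (τ/(p μ₀)) ln(1 + 4(μ₀ − 1)/N)
of the Bakhvalov-type x-mesh satisfies (τ/(2p)) μ₀⁻¹ ≤ h_{x,N/4−1} ≤ (4τ/p) N⁻¹. -/
theorem transition_left_width_bounds (τ p μ₀ : ℝ) (N : ℕ)
    (hτ : 0 < τ) (hp0 : 0 < p) (hp1 : p < 1)
    (hN : 8 ≤ N) (hN4 : 4 ∣ N) (hμ : (N : ℝ) ≤ μ₀) :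
    let x : ℕ → ℝ := fun i =>
      (τ / (p * μ₀)) * (-Real.log (1 - 4 * (1 - μ₀⁻¹) * ((i : ℝ) / (N : ℝ))))
    let h : ℕ → ℝ := fun i => x (i + 1) - x i
    h (N / 4 - 1) = (τ / (p * μ₀)) * Real.log (1 + 4 * (μ₀ - 1) / (N : ℝ)) ∧
      τ / (2 * p) * μ₀⁻¹ ≤ h (N / 4 - 1) ∧ h (N / 4 - 1) ≤ 4 * τ / p * (N : ℝ)⁻¹ := by
  intro x h
  have hNR : (8 : ℝ) ≤ N := by exact_mod_cast hN
  have hNpos : (0 : ℝ) < N := by linarith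
  have hμ0 : 0 < μ₀ := by linarith
  have hy : 1 ≤ 4 * (μ₀ - 1) / (N : ℝ) := by
    rw [le_div_iff₀ hNpos]; linarith
  have key : h (N / 4 - 1) = (τ / (p * μ₀)) * Real.log (1 + 4 * (μ₀ - 1) / (N : ℝ)) := by
    obtain ⟨k, rfl⟩ := hN4
    obtain ⟨m, rfl⟩ : ∃ m, k = m + 1 := ⟨k - 1, by omega⟩
    have e : 4 * (m + 1) / 4 - 1 = m := by omega
    rw [e]
    have hm : (0 : ℝ) < (m : ℝ) + 1 := by positivity
    have e1 : 1 - 4 * (1 - μ₀⁻¹) * (((m + 1 : ℕ) : ℝ) / ((4 * (m + 1) : ℕ) : ℝ)) = μ₀⁻¹ := by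
      push_cast; field_simp; ring
    have e2 : 1 - 4 * (1 - μ₀⁻¹) * ((m : ℝ) / ((4 * (m + 1) : ℕ) : ℝ))
        = μ₀⁻¹ * (1 + 4 * (μ₀ - 1) / ((4 * (m + 1) : ℕ) : ℝ)) := by
      push_cast; field_simp; ring
    simp only [h, x]
    rw [e1, e2, Real.log_mul (by positivity) (by linarith)]
    ring
  have hl := Real.one_sub_inv_le_log_of_pos
    (show 0 < 1 + 4 * (μ₀ - 1) / (N : ℝ) by linarith)
  have hu := Real.log_le_sub_one_of_pos
    (show 0 < 1 + 4 * (μ₀ - 1) / (N : ℝ) by linarith)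
  have hinv : (1 + 4 * (μ₀ - 1) / (N : ℝ))⁻¹ ≤ 2⁻¹ :=
    inv_anti₀ (by norm_num) (by linarith)
  have hc : 0 ≤ τ / (p * μ₀) := by positivity
  refine ⟨key, ?_, ?_⟩
  · rw [key]
    calc τ / (2 * p) * μ₀⁻¹ = τ / (p * μ₀) * 2⁻¹ := by field_simp
      _ ≤ _ := mul_le_mul_of_nonneg_left (by linarith) hc
  · rw [key]
    have h4 : 4 * (μ₀ - 1) / (N : ℝ) ≤ 4 * μ₀ / N := by gcongr; linarith
    calc _ ≤ τ / (p * μ₀) * (4 * μ₀ / N) := mul_le_mul_of_nonneg_left (by linarith) hc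
      _ = 4 * τ / p * (N : ℝ)⁻¹ := by field_simp
end

section
/- Let τ > 0, p ∈ (0,1), let N ≥ 8 be an integer divisible by 4, and let μ₁ ≥ N. Then the widths of the right graded part of the Bakhvalov-type x-mesh satisfy (τ/(4p)) μ₁⁻¹ ≤ h_{x,3N/4+1} ≤ (τ/p) μ₁⁻¹, the widths are nonincreasing, h_{x,3N/4+1} ≥ h_{x,3N/4+2} ≥ ⋯ ≥ h_{x,N−1}, and h_{x,N−1} ≥ (7τ/(2p)) μ₁⁻¹ N⁻¹. -/
/-- Let τ > 0, p ∈ (0,1), let N ≥ 8 be an integer divisible by 4, and let μ₁ ≥ N.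
Then the widths of the right graded part of the Bakhvalov-type x-mesh,
x_i = 1 − (τ/(p μ₁)) · (−ln(1 − 4(1 − μ₁⁻¹)(1 − i/N))), satisfy
(τ/(4p)) μ₁⁻¹ ≤ h_{x,3N/4+1} ≤ (τ/p) μ₁⁻¹, the widths are nonincreasing,
h_{x,3N/4+1} ≥ h_{x,3N/4+2} ≥ ⋯ ≥ h_{x,N−1}, and h_{x,N−1} ≥ (7τ/(2p)) μ₁⁻¹ N⁻¹. -/
theorem right_graded_mesh_widths (τ p μ₁ : ℝ) (N : ℕ)
    (hτ : 0 < τ) (hp0 : 0 < p) (hp1 : p < 1)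
    (hN : 8 ≤ N) (hN4 : 4 ∣ N) (hμ : (N : ℝ) ≤ μ₁) :
    let x : ℕ → ℝ := fun i =>
      1 - (τ / (p * μ₁)) * (-Real.log (1 - 4 * (1 - μ₁⁻¹) * (1 - (i : ℝ) / (N : ℝ))))
    let h : ℕ → ℝ := fun i => x (i + 1) - x i
    (τ / (4 * p) * μ₁⁻¹ ≤ h (3 * N / 4 + 1) ∧ h (3 * N / 4 + 1) ≤ τ / p * μ₁⁻¹) ∧
      (∀ i j : ℕ, 3 * N / 4 + 1 ≤ i → i ≤ j → j ≤ N - 1 → h j ≤ h i) ∧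
      7 * τ / (2 * p) * μ₁⁻¹ * (N : ℝ)⁻¹ ≤ h (N - 1) := by
  intro x h
  obtain ⟨k, rfl⟩ := hN4
  have hk2 : 2 ≤ k := by omega
  have hkR : (2:ℝ) ≤ (k:ℝ) := by exact_mod_cast hk2
  have hk0 : (0:ℝ) < (k:ℝ) := by linarith
  have hdiv : 3 * (4 * k) / 4 = 3 * k := by omega
  rw [hdiv]
  push_cast at hμ
  have hμ8 : 8 ≤ μ₁ := by linarith
  have hμ0 : 0 < μ₁ := by linarith
  obtain ⟨v, hv⟩ : ∃ v, v = μ₁⁻¹ := ⟨_, rfl⟩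
  have hv0 : 0 < v := by rw [hv]; positivity
  have hvμ : v * μ₁ = 1 := by rw [hv]; field_simp
  have hv8 : v ≤ 1 / 8 := by nlinarith
  obtain ⟨d, hd⟩ : ∃ d, d = (1 - v) / k := ⟨_, rfl⟩
  have hdk : d * k = 1 - v := by rw [hd]; field_simp
  have hd0 : 0 < d := by rw [hd]; apply div_pos <;> linarith
  have hdv : 7 / 2 * v ≤ d := by
    have h1 : 4 * k * v ≤ 1 := by nlinarith
    have h2 : 7 / 2 * v * k ≤ d * k := by rw [hdk]; nlinarith
    exact le_of_mul_le_mul_right h2 hk0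
  let G : ℕ → ℝ := fun i => v + d * ((i : ℝ) - 3 * k)
  have hG : ∀ i : ℕ, 1 - 4 * (1 - μ₁⁻¹) * (1 - (i : ℝ) / ((4 * k : ℕ) : ℝ)) = G i := by
    intro i
    simp only [G, hd, ← hv]
    push_cast
    field_simp
    ring
  obtain ⟨C, hC⟩ : ∃ C, C = τ / (p * μ₁) := ⟨_, rfl⟩
  have hC0 : 0 < C := by rw [hC]; positivity
  have hGs : ∀ i : ℕ, G (i + 1) = G i + d := by
    intro i; simp only [G]; push_cast; ring
  have hGp : ∀ i : ℕ, 3 * k + 1 ≤ i → 0 < G i := by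
    intro i hi
    have : (3 * k + 1 : ℝ) ≤ i := by exact_mod_cast hi
    simp only [G]
    nlinarith
  have hh : ∀ i : ℕ, 3 * k + 1 ≤ i → h i = C * Real.log ((G i + d) / G i) := by
    intro i hi
    have h1 := hGp i hi
    rw [Real.log_div (by linarith) h1.ne', ← hGs]
    simp only [h, x]
    rw [hG, hG, ← hC]
    ring
  have hG1 : G (3 * k + 1) = v + d := by simp only [G]; push_cast; ring
  have lower : ∀ y : ℝ, 0 < y → d / (y + d) ≤ Real.log ((y + d) / y) := by
    intro y hy
    have := Real.one_sub_inv_le_log_of_pos (x := (y + d) / y) (by positivity)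
    refine le_trans (le_of_eq ?_) this
    field_simp
    ring
  refine ⟨⟨?_, ?_⟩, ?_, ?_⟩
  · rw [hh _ le_rfl, hG1]
    have h1 := lower (v + d) (by positivity)
    have h2 : 1 / 4 ≤ d / (v + d + d) := by
      rw [div_le_div_iff₀ (by norm_num) (by positivity)]; linarith
    have h3 : τ / (4 * p) * μ₁⁻¹ = C * (1 / 4) := by rw [hC]; field_simp
    rw [h3]
    exact mul_le_mul_of_nonneg_left (h2.trans h1) hC0.le
  · rw [hh _ le_rfl, hG1]
    have h1 := Real.log_le_sub_one_of_pos (x := (v + d + d) / (v + d)) (by positivity)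
    have h2 : (v + d + d) / (v + d) ≤ 2 := by
      rw [div_le_iff₀ (by positivity)]; linarith
    have h3 : τ / p * μ₁⁻¹ = C * 1 := by rw [hC]; field_simp
    rw [h3]
    exact mul_le_mul_of_nonneg_left (by linarith) hC0.le
  · intro i j hi hij _
    rw [hh i hi, hh j (hi.trans hij)]
    have h1 := hGp i hi
    have h2 := hGp j (hi.trans hij)
    have h3 : G i ≤ G j := by
      have : (i : ℝ) ≤ j := by exact_mod_cast hij
      simp only [G]
      nlinarith
    apply mul_le_mul_of_nonneg_left _ hC0.le
    apply Real.log_le_log (by positivity)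
    rw [div_le_div_iff₀ h2 h1]
    nlinarith
  · have hi : 3 * k + 1 ≤ 4 * k - 1 := by omega
    rw [hh _ hi]
    have h1 := lower _ (hGp _ hi)
    have h4 : G (4 * k - 1) + d = 1 := by
      rw [← hGs, Nat.sub_add_cancel (by omega)]
      simp only [G]; push_cast; linarith
    rw [h4] at h1 ⊢
    have h3 : 7 * τ / (2 * p) * μ₁⁻¹ * ((4 * k : ℕ) : ℝ)⁻¹ = C * (7 / 8 / k) := by
      rw [hC]; push_cast; field_simp; norm_num
    rw [h3]
    have h2 : 7 / 8 / (k:ℝ) ≤ d := by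
      rw [div_le_iff₀ hk0, hdk]; linarith
    rw [div_one] at h1
    exact mul_le_mul_of_nonneg_left (h2.trans h1) hC0.le
end

section
/- Let τ > 0, δ > 0, c₀ > 0, let N ≥ 8 be an integer divisible by 4, and let ε₁ ∈ (0,1) satisfy √ε₁ ≤ √c₀ · N⁻¹ and √ε₁ ≤ 1/8. Then the transitional widths of the Bakhvalov-type y-mesh satisfy (τ/(δ(√c₀ + 8))) √ε₁ ≤ h_{y,N/4−2} ≤ (τ/δ) √ε₁ and (τ/(δ(√c₀ + 4))) √ε₁ ≤ h_{y,N/4−1} ≤ (4τ/δ) N⁻¹. -/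
lemma aux_log_bounds (a b : ℝ) (ha : 0 < a) (hb : 0 < b) :
    (b - a) / b ≤ Real.log b - Real.log a ∧ Real.log b - Real.log a ≤ (b - a) / a := by
  rw [← Real.log_div hb.ne' ha.ne']
  constructor
  · have h := Real.one_sub_inv_le_log_of_pos (div_pos hb ha)
    rw [inv_div] at h
    rw [sub_div, div_self hb.ne']
    exact h
  · have h := Real.log_le_sub_one_of_pos (div_pos hb ha)
    rw [sub_div, div_self ha.ne']
    exact h

/-- Let τ > 0, δ > 0, c₀ > 0, let N ≥ 8 be an integer divisible by 4, and let
ε₁ ∈ (0,1) satisfy √ε₁ ≤ √c₀ · N⁻¹ and √ε₁ ≤ 1/8. Then the transitional widths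
of the Bakhvalov-type y-mesh satisfy
(τ/(δ(√c₀ + 8))) √ε₁ ≤ h_{y,N/4−2} ≤ (τ/δ) √ε₁ and
(τ/(δ(√c₀ + 4))) √ε₁ ≤ h_{y,N/4−1} ≤ (4τ/δ) N⁻¹. -/
theorem y_mesh_transition_widths (τ δ c₀ ε₁ : ℝ) (N : ℕ)
    (hτ : 0 < τ) (hδ : 0 < δ) (hc₀ : 0 < c₀)
    (hN : 8 ≤ N) (hN4 : 4 ∣ N) (hε : ε₁ ∈ Set.Ioo (0 : ℝ) 1)
    (hεN : Real.sqrt ε₁ ≤ Real.sqrt c₀ * (N : ℝ)⁻¹) (hε8 : Real.sqrt ε₁ ≤ 1 / 8) :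
    let y : ℕ → ℝ := fun j =>
      (τ / δ) * Real.sqrt ε₁ * (-Real.log (1 - 4 * (1 - Real.sqrt ε₁) * ((j : ℝ) / (N : ℝ))))
    let h : ℕ → ℝ := fun j => y (j + 1) - y j
    (τ / (δ * (Real.sqrt c₀ + 8)) * Real.sqrt ε₁ ≤ h (N / 4 - 2) ∧
        h (N / 4 - 2) ≤ τ / δ * Real.sqrt ε₁) ∧
      (τ / (δ * (Real.sqrt c₀ + 4)) * Real.sqrt ε₁ ≤ h (N / 4 - 1) ∧
        h (N / 4 - 1) ≤ 4 * τ / δ * (N : ℝ)⁻¹) := by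
  intro y h
  obtain ⟨M, rfl⟩ := hN4
  obtain ⟨K, rfl⟩ : ∃ K, M = K + 2 := ⟨M - 2, by omega⟩
  have e1 : 4 * (K + 2) / 4 - 2 = K := by omega
  have e2 : 4 * (K + 2) / 4 - 1 = K + 1 := by omega
  rw [e1, e2]
  have hs : 0 < Real.sqrt ε₁ := Real.sqrt_pos.mpr hε.1
  have hC : 0 < Real.sqrt c₀ := Real.sqrt_pos.mpr hc₀
  simp only [h, y]
  clear h y
  generalize Real.sqrt ε₁ = s at *
  generalize Real.sqrt c₀ = C at *
  push_cast at *
  have hK : (0 : ℝ) < (K : ℝ) + 2 := by positivity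
  obtain ⟨n, hn⟩ : ∃ n : ℝ, n = (4 * ((K : ℝ) + 2))⁻¹ := ⟨_, rfl⟩
  have hn0 : 0 < n := by rw [hn]; positivity
  obtain ⟨q, hq⟩ : ∃ q : ℝ, q = 4 * (1 - s) * n := ⟨_, rfl⟩
  have hq1 : 3.5 * n ≤ q := by rw [hq]; nlinarith
  have hq2 : q ≤ 4 * n := by rw [hq]; nlinarith
  have hq0 : 0 < q := by linarith
  have a0 : 1 - 4 * (1 - s) * ((K : ℝ) / (4 * ((K : ℝ) + 2))) = s + 2 * q := by
    rw [hq, hn]; field_simp; ring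
  have a1 : 1 - 4 * (1 - s) * (((K : ℝ) + 1) / (4 * ((K : ℝ) + 2))) = s + q := by
    rw [hq, hn]; field_simp; ring
  have a2 : 1 - 4 * (1 - s) * (((K : ℝ) + 1 + 1) / (4 * ((K : ℝ) + 2))) = s := by
    field_simp; ring
  rw [a0, a1, a2, ← hn]
  rw [← hn] at hεN
  have hqC : s ≤ q * C := by nlinarith
  obtain ⟨l1, u1⟩ := aux_log_bounds (s + q) (s + 2 * q) (by positivity) (by positivity)
  obtain ⟨l2, u2⟩ := aux_log_bounds s (s + q) (by positivity) (by positivity)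
  have L1 : 1 / (C + 8) ≤ Real.log (s + 2 * q) - Real.log (s + q) := by
    refine le_trans ?_ l1
    rw [div_le_div_iff₀ (by positivity) (by positivity)]
    nlinarith
  have U1 : Real.log (s + 2 * q) - Real.log (s + q) ≤ 1 := by
    refine le_trans u1 ?_
    rw [div_le_one (by positivity)]
    linarith
  have L2 : 1 / (C + 4) ≤ Real.log (s + q) - Real.log s := by
    refine le_trans ?_ l2
    rw [div_le_div_iff₀ (by positivity) (by positivity)]
    nlinarith
  have U2 : s * (Real.log (s + q) - Real.log s) ≤ 4 * n := by
    rw [le_div_iff₀ hs] at u2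
    linarith
  have hp : 0 < τ / δ := by positivity
  have hps : 0 < τ / δ * s := by positivity
  refine ⟨⟨?_, ?_⟩, ?_, ?_⟩
  · calc τ / (δ * (C + 8)) * s = τ / δ * s * (1 / (C + 8)) := by field_simp
      _ ≤ τ / δ * s * (Real.log (s + 2 * q) - Real.log (s + q)) :=
        mul_le_mul_of_nonneg_left L1 hps.le
      _ = _ := by ring
  · have := mul_le_mul_of_nonneg_left U1 hps.le
    linarith
  · calc τ / (δ * (C + 4)) * s = τ / δ * s * (1 / (C + 4)) := by field_simp
      _ ≤ τ / δ * s * (Real.log (s + q) - Real.log s) :=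
        mul_le_mul_of_nonneg_left L2 hps.le
      _ = _ := by ring
  · have := mul_le_mul_of_nonneg_left U2 hp.le
    calc _ = τ / δ * (s * (Real.log (s + q) - Real.log s)) := by ring
      _ ≤ τ / δ * (4 * n) := this
      _ = _ := by ring
end

section
/- Let τ > 0, δ > 0, let N ≥ 8 be an integer divisible by 4, and let ε₁ ∈ (0,1) satisfy √ε₁ ≤ 1/8. Then the widths of the bottom graded part of the Bakhvalov-type y-mesh are nondecreasing, h_{y,0} ≤ h_{y,1} ≤ ⋯ ≤ h_{y,N/4−2}, and the first width satisfies h_{y,0} ≥ (7τ/(2δ)) √ε₁ · N⁻¹. -/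
/-- Let τ > 0, δ > 0, let N ≥ 8 be an integer divisible by 4, and let ε₁ ∈ (0,1)
satisfy √ε₁ ≤ 1/8. Then the widths of the bottom graded part of the
Bakhvalov-type y-mesh are nondecreasing, h_{y,0} ≤ h_{y,1} ≤ ⋯ ≤ h_{y,N/4−2},
and the first width satisfies h_{y,0} ≥ (7τ/(2δ)) √ε₁ · N⁻¹. -/
theorem y_mesh_graded_widths (τ δ ε₁ : ℝ) (N : ℕ)
    (hτ : 0 < τ) (hδ : 0 < δ)
    (hN : 8 ≤ N) (hN4 : 4 ∣ N) (hε : ε₁ ∈ Set.Ioo (0 : ℝ) 1)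
    (hε8 : Real.sqrt ε₁ ≤ 1 / 8) :
    let y : ℕ → ℝ := fun j =>
      (τ / δ) * Real.sqrt ε₁ * (-Real.log (1 - 4 * (1 - Real.sqrt ε₁) * ((j : ℝ) / (N : ℝ))))
    let h : ℕ → ℝ := fun j => y (j + 1) - y j
    (∀ i j : ℕ, i ≤ j → j ≤ N / 4 - 2 → h i ≤ h j) ∧
      7 * τ / (2 * δ) * Real.sqrt ε₁ * (N : ℝ)⁻¹ ≤ h 0 := by
  intro y h
  have hs : 0 < Real.sqrt ε₁ := Real.sqrt_pos.mpr hε.1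
  have hNR : (8 : ℝ) ≤ N := by exact_mod_cast hN
  have hN0 : (0 : ℝ) < N := by linarith
  set s := Real.sqrt ε₁ with hsdef
  have hc : 0 < τ / δ * s := by positivity
  obtain ⟨a, ha⟩ : ∃ a : ℝ, a = 4 * (1 - s) / N := ⟨_, rfl⟩
  have ha0 : 0 < a := by rw [ha]; apply div_pos <;> linarith
  have haN : a * N = 4 * (1 - s) := by rw [ha]; field_simp
  have hy : ∀ j : ℕ, y j = τ / δ * s * (-Real.log (1 - a * j)) := by
    intro j
    have e : 4 * (1 - s) * ((j : ℝ) / (N : ℝ)) = a * j := by rw [ha]; ring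
    rw [← e]
  have hpos : ∀ k : ℕ, 4 * k ≤ N → 0 < 1 - a * k := by
    intro k hk
    have hk' : (4 : ℝ) * k ≤ N := by exact_mod_cast hk
    have := mul_le_mul_of_nonneg_left hk' ha0.le
    nlinarith
  constructor
  · intro i j hij hj
    have p1 := hpos i (by omega)
    have p2 := hpos (i + 1) (by omega)
    have p3 := hpos j (by omega)
    have p4 := hpos (j + 1) (by omega)
    have hij' : (i : ℝ) ≤ j := by exact_mod_cast hij
    simp only [h, hy]
    have key : (1 - a * (i : ℝ)) * (1 - a * ((j + 1 : ℕ) : ℝ))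
        ≤ (1 - a * (j : ℝ)) * (1 - a * ((i + 1 : ℕ) : ℝ)) := by
      push_cast
      nlinarith [mul_nonneg (sq_nonneg a) (sub_nonneg.mpr hij')]
    have hl := Real.log_le_log (mul_pos p1 p4) key
    rw [Real.log_mul p1.ne' p4.ne', Real.log_mul p3.ne' p2.ne'] at hl
    rw [← mul_sub, ← mul_sub]
    apply mul_le_mul_of_nonneg_left _ hc.le
    linarith
  · have p := hpos 1 (by omega)
    simp only [h, hy]
    have hl := Real.log_le_sub_one_of_pos p
    have e : 7 * τ / (2 * δ) * s * (N : ℝ)⁻¹ = τ / δ * s * (7 / 2 / N) := by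
      field_simp
    rw [e, ← mul_sub]
    apply mul_le_mul_of_nonneg_left _ hc.le
    have h2 : 7 / 2 / (N : ℝ) ≤ a := by
      rw [ha]; gcongr; linarith
    simp at hl ⊢
    linarith
end

section
/- Let τ > 0, p ∈ (0,1), and let m be a real number with 0 ≤ m ≤ τ. There exists a constant C > 0, depending only on τ, p and m, such that for every integer N ≥ 8 divisible by 4, every μ₀ ≥ N, and every index 0 ≤ i ≤ N/4 − 2, the Bakhvalov-type x-mesh satisfies h_{x,i}^m · e^{−p μ₀ x_i} ≤ C μ₀^{−m} N^{−m}. -/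
/-- Let τ > 0, p ∈ (0,1), and let m be a real number with 0 ≤ m ≤ τ.
There exists a constant C > 0, depending only on τ, p and m, such that for every
integer N ≥ 8 divisible by 4, every μ₀ ≥ N, and every index 0 ≤ i ≤ N/4 − 2,
the Bakhvalov-type x-mesh satisfies h_{x,i}^m · e^{−p μ₀ x_i} ≤ C μ₀^{−m} N^{−m}. -/
theorem graded_width_decay_bound (τ p m : ℝ)
    (hτ : 0 < τ) (hp0 : 0 < p) (hp1 : p < 1) (hm0 : 0 ≤ m) (hmτ : m ≤ τ) :
    ∃ C : ℝ, 0 < C ∧ ∀ (N : ℕ), 8 ≤ N → 4 ∣ N → ∀ μ₀ : ℝ, (N : ℝ) ≤ μ₀ →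
      ∀ i : ℕ, i ≤ N / 4 - 2 →
        ((τ / (p * μ₀)) * (-Real.log (1 - 4 * (1 - μ₀⁻¹) * (((i : ℝ) + 1) / (N : ℝ)))) -
            (τ / (p * μ₀)) * (-Real.log (1 - 4 * (1 - μ₀⁻¹) * ((i : ℝ) / (N : ℝ))))) ^ m *
          Real.exp (-(p * μ₀ *
            ((τ / (p * μ₀)) * (-Real.log (1 - 4 * (1 - μ₀⁻¹) * ((i : ℝ) / (N : ℝ))))))) ≤
        C * μ₀ ^ (-m) * (N : ℝ) ^ (-m) := by
  refine ⟨(8 * τ / p) ^ m, by positivity, ?_⟩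
  intro N hN hd μ hμ i hi
  have hi' : 4 * (i + 2) ≤ N := by omega
  have hiR : 4 * ((i : ℝ) + 2) ≤ N := by exact_mod_cast hi'
  have hN8 : (8 : ℝ) ≤ N := by exact_mod_cast hN
  have hN0 : (0 : ℝ) < N := by linarith
  have hμ0 : 0 < μ := by linarith
  have hi0 : (0 : ℝ) ≤ i := Nat.cast_nonneg i
  have hinv0 : 0 < μ⁻¹ := by positivity
  have hinv1 : μ⁻¹ ≤ 1 := inv_le_one_of_one_le₀ (by linarith)
  obtain ⟨k, hk⟩ : ∃ k, k = 1 - μ⁻¹ := ⟨_, rfl⟩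
  have hk0 : 0 ≤ k := by linarith
  have hk1 : k ≤ 1 := by linarith
  obtain ⟨a, ha⟩ : ∃ a, a = 1 - 4 * (1 - μ⁻¹) * ((i : ℝ) / (N : ℝ)) := ⟨_, rfl⟩
  obtain ⟨b, hb⟩ : ∃ b, b = 1 - 4 * (1 - μ⁻¹) * (((i : ℝ) + 1) / (N : ℝ)) := ⟨_, rfl⟩
  rw [← ha, ← hb]
  rw [← hk] at ha hb
  have hab : a - b = 4 * k / N := by rw [ha, hb]; ring
  have h4 : 0 < 4 / (N : ℝ) := by positivity
  have hd0 : 0 ≤ a - b := by rw [hab]; positivity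
  have hd1 : a - b ≤ 4 / N := by
    rw [hab]; gcongr; linarith
  have hq : ((i : ℝ) + 1) / N ≤ 1 / 4 - 1 / N := by
    rw [div_le_iff₀ hN0, sub_mul, one_div_mul_cancel hN0.ne']; linarith
  have hq0 : 0 ≤ ((i : ℝ) + 1) / N := by positivity
  have hb4 : 4 / (N : ℝ) ≤ b := by
    have h1 : k * (((i : ℝ) + 1) / N) ≤ ((i : ℝ) + 1) / N := mul_le_of_le_one_left hq0 hk1
    have h2 : 4 / (N : ℝ) = 4 * (1 / N) := by ring
    rw [hb, h2]; linarith
  have hb0 : 0 < b := by linarith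
  have ha0 : 0 < a := by linarith
  have ha1 : a ≤ 1 := by
    have : 0 ≤ 4 * k * ((i : ℝ) / N) := by positivity
    linarith
  have hlog0 : 0 ≤ Real.log a - Real.log b := by
    have := Real.log_le_log hb0 (by linarith : b ≤ a)
    linarith
  have hlog : (Real.log a - Real.log b) * a ≤ 8 / N := by
    rw [← Real.log_div ha0.ne' hb0.ne'] at hlog0 ⊢
    have h1 := Real.log_le_sub_one_of_pos (div_pos ha0 hb0)
    have h2 : Real.log (a / b) * b ≤ a - b := by
      calc Real.log (a / b) * b ≤ (a / b - 1) * b := by gcongr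
        _ = a - b := by field_simp
    have h3 : Real.log (a / b) * a ≤ Real.log (a / b) * (2 * b) := by
      gcongr; linarith
    have h5 : 8 / (N : ℝ) = 2 * (4 / N) := by ring
    rw [h5]; linarith
  have hexp : Real.exp (-(p * μ * ((τ / (p * μ)) * (-Real.log a)))) = a ^ τ := by
    rw [Real.rpow_def_of_pos ha0]
    congr 1
    field_simp
  have hh : (τ / (p * μ)) * (-Real.log b) - (τ / (p * μ)) * (-Real.log a)
      = (τ / (p * μ)) * (Real.log a - Real.log b) := by ring
  rw [hexp, hh]
  have hh0 : 0 ≤ (τ / (p * μ)) * (Real.log a - Real.log b) := by positivity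
  calc _ ≤ ((τ / (p * μ)) * (Real.log a - Real.log b)) ^ m * a ^ m := by
        exact mul_le_mul_of_nonneg_left
          (Real.rpow_le_rpow_of_exponent_ge ha0 ha1 hmτ) (Real.rpow_nonneg hh0 m)
    _ = ((τ / (p * μ)) * ((Real.log a - Real.log b) * a)) ^ m := by
        rw [← Real.mul_rpow hh0 ha0.le, mul_assoc]
    _ ≤ ((τ / (p * μ)) * (8 / N)) ^ m := by
        apply Real.rpow_le_rpow (by positivity) _ hm0
        gcongr
    _ = ((8 * τ / p) * μ⁻¹ * (N : ℝ)⁻¹) ^ m := by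
        congr 1; field_simp
    _ = _ := by
        rw [Real.mul_rpow (by positivity) (by positivity),
          Real.mul_rpow (by positivity) (by positivity),
          Real.inv_rpow hμ0.le, Real.inv_rpow hN0.le,
          Real.rpow_neg hμ0.le, Real.rpow_neg hN0.le]
end

section
/- Let τ > 0, p ∈ (0,1), and let m be a real number with 0 ≤ m ≤ τ. There exists a constant C > 0, depending only on τ, p and m, such that for every integer N ≥ 8 divisible by 4, every μ₁ ≥ N, and every index 3N/4 + 1 ≤ i ≤ N − 1, the Bakhvalov-type x-mesh satisfies h_{x,i}^m · e^{−p μ₁ (1 − x_{i+1})} ≤ C μ₁^{−m} N^{−m}. -/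
/-- Let τ > 0, p ∈ (0,1), and let m be a real number with 0 ≤ m ≤ τ.
There exists a constant C > 0, depending only on τ, p and m, such that for every
integer N ≥ 8 divisible by 4, every μ₁ ≥ N, and every index 3N/4 + 1 ≤ i ≤ N − 1,
the Bakhvalov-type x-mesh satisfies h_{x,i}^m · e^{−p μ₁ (1 − x_{i+1})} ≤ C μ₁^{−m} N^{−m},
where x_i = 1 − (τ/(p μ₁)) · (−ln(1 − 4(1 − μ₁⁻¹)(1 − i/N))). -/
theorem right_graded_width_decay_bound (τ p m : ℝ)
    (hτ : 0 < τ) (hp0 : 0 < p) (hp1 : p < 1) (hm0 : 0 ≤ m) (hmτ : m ≤ τ) :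
    ∃ C : ℝ, 0 < C ∧ ∀ (N : ℕ), 8 ≤ N → 4 ∣ N → ∀ μ₁ : ℝ, (N : ℝ) ≤ μ₁ →
      ∀ i : ℕ, 3 * N / 4 + 1 ≤ i → i ≤ N - 1 →
        ((1 - (τ / (p * μ₁)) *
              (-Real.log (1 - 4 * (1 - μ₁⁻¹) * (1 - ((i : ℝ) + 1) / (N : ℝ))))) -
            (1 - (τ / (p * μ₁)) *
              (-Real.log (1 - 4 * (1 - μ₁⁻¹) * (1 - (i : ℝ) / (N : ℝ)))))) ^ m *
          Real.exp (-(p * μ₁ * (1 - (1 - (τ / (p * μ₁)) *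
            (-Real.log (1 - 4 * (1 - μ₁⁻¹) * (1 - ((i : ℝ) + 1) / (N : ℝ)))))))) ≤
        C * μ₁ ^ (-m) * (N : ℝ) ^ (-m) := by
  refine ⟨(8 * τ / p) ^ m, by positivity, ?_⟩
  intro N hN8 hN4 μ hμ i hi1 hi2
  obtain ⟨k, rfl⟩ := hN4
  have hi1' : 3 * k + 1 ≤ i := by omega
  have hi2' : i + 1 ≤ 4 * k := by omega
  have hNr : (8 : ℝ) ≤ ((4 * k : ℕ) : ℝ) := by exact_mod_cast hN8
  have h1 : 3 * ((4 * k : ℕ) : ℝ) / 4 + 1 ≤ (i : ℝ) := by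
    have : ((3 * k + 1 : ℕ) : ℝ) ≤ i := by exact_mod_cast hi1'
    push_cast at this ⊢
    linarith
  have h2 : (i : ℝ) + 1 ≤ ((4 * k : ℕ) : ℝ) := by exact_mod_cast hi2'
  generalize ((4 * k : ℕ) : ℝ) = n at *
  generalize (i : ℝ) = x at *
  have hn : 0 < n := by linarith
  have hμ0 : 0 < μ := by linarith
  have hq0 : 0 < μ⁻¹ := by positivity
  have hq1 : μ⁻¹ ≤ 1 := inv_le_one_of_one_le₀ (by linarith)
  generalize hA : 1 - 4 * (1 - μ⁻¹) * (1 - (x + 1) / n) = A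
  generalize hB : 1 - 4 * (1 - μ⁻¹) * (1 - x / n) = B
  have hAB : A - B = 4 * (1 - μ⁻¹) * (1 / n) := by rw [← hA, ← hB]; ring
  have hin : 0 < 1 / n := by positivity
  have hd : A - B ≤ 4 * (1 / n) := by rw [hAB]; nlinarith
  have hd0 : 0 ≤ A - B := by
    rw [hAB]; exact mul_nonneg (by linarith) hin.le
  have hx1 : 3 / 4 + 1 / n ≤ x / n := by
    have : 3 / 4 + 1 / n = (3 * n / 4 + 1) / n := by field_simp
    rw [this]; gcongr
  have hx2 : (x + 1) / n ≤ 1 := by rw [div_le_one hn]; exact h2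
  have hx3 : x / n ≤ 1 := by rw [div_le_one hn]; linarith
  have hBn : 4 * (1 / n) ≤ B := by
    rw [← hB]
    have : 0 ≤ μ⁻¹ * (1 - x / n) := mul_nonneg hq0.le (by linarith)
    nlinarith
  have hA1 : A ≤ 1 := by
    rw [← hA]
    have : 0 ≤ (1 - μ⁻¹) * (1 - (x + 1) / n) := mul_nonneg (by linarith) (by linarith)
    linarith
  have hB0 : 0 < B := by linarith
  have hA0 : 0 < A := by linarith
  have hA2 : A ≤ 2 * B := by linarith
  have hexp : Real.exp (-(p * μ * (1 - (1 - τ / (p * μ) * -Real.log A)))) = A ^ τ := by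
    rw [Real.rpow_def_of_pos hA0]
    congr 1
    field_simp
    ring
  have hlog : Real.log A - Real.log B ≤ (A - B) / B := by
    rw [← Real.log_div hA0.ne' hB0.ne']
    have := Real.log_le_sub_one_of_pos (div_pos hA0 hB0)
    rwa [sub_div, div_self hB0.ne']
  have hlog0 : 0 ≤ Real.log A - Real.log B :=
    sub_nonneg.2 (Real.log_le_log hB0 (by linarith))
  have hh : (1 - τ / (p * μ) * -Real.log A) - (1 - τ / (p * μ) * -Real.log B)
      = τ / (p * μ) * (Real.log A - Real.log B) := by ring
  rw [hexp, hh]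
  have hc : 0 < τ / (p * μ) := by positivity
  have hlA : (Real.log A - Real.log B) * A ≤ 8 * (1 / n) := by
    calc (Real.log A - Real.log B) * A ≤ ((A - B) / B) * (2 * B) := by gcongr
      _ = 2 * (A - B) := by field_simp
      _ ≤ _ := by linarith
  calc (τ / (p * μ) * (Real.log A - Real.log B)) ^ m * A ^ τ
      ≤ (τ / (p * μ) * (Real.log A - Real.log B)) ^ m * A ^ m := by
        gcongr ?_ * ?_
        exact Real.rpow_le_rpow_of_exponent_ge hA0 hA1 hmτ
    _ = (τ / (p * μ) * ((Real.log A - Real.log B) * A)) ^ m := by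
        rw [← Real.mul_rpow (by positivity) hA0.le, mul_assoc]
    _ ≤ (τ / (p * μ) * (8 * (1 / n))) ^ m := by
        gcongr
    _ = (8 * τ / p * μ⁻¹ * n⁻¹) ^ m := by
        congr 1
        field_simp
    _ = _ := by
        rw [Real.mul_rpow (by positivity) (by positivity),
          Real.mul_rpow (by positivity) (by positivity),
          Real.inv_rpow hμ0.le, Real.inv_rpow hn.le,
          Real.rpow_neg hμ0.le, Real.rpow_neg hn.le]
end

section
/- Let τ > 0, δ > 0, c₀ > 0, and let m be a real number with 0 ≤ m ≤ τ. There exists a constant C > 0, depending only on τ, δ, c₀ and m, such that for every integer N ≥ 8 divisible by 4 and every ε₁ ∈ (0,1) with √ε₁ ≤ √c₀ · N⁻¹ and √ε₁ ≤ 1/8, and every index 0 ≤ j ≤ N/4 − 2, the Bakhvalov-type y-mesh satisfies h_{y,j}^m · e^{−δ y_j / √ε₁} ≤ C ε₁^{m/2} N^{−m}. -/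
/-- Let τ > 0, δ > 0, c₀ > 0, and let m be a real number with 0 ≤ m ≤ τ.
There exists a constant C > 0, depending only on τ, δ, c₀ and m, such that for
every integer N ≥ 8 divisible by 4 and every ε₁ ∈ (0,1) with √ε₁ ≤ √c₀ · N⁻¹ and
√ε₁ ≤ 1/8, and every index 0 ≤ j ≤ N/4 − 2, the Bakhvalov-type y-mesh satisfies
h_{y,j}^m · e^{−δ y_j / √ε₁} ≤ C ε₁^{m/2} N^{−m}, where
y_j = (τ/δ)√ε₁ · (−ln(1 − 4(1 − √ε₁) j/N)). -/
theorem y_graded_width_decay_bound (τ δ c₀ m : ℝ)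
    (hτ : 0 < τ) (hδ : 0 < δ) (hc₀ : 0 < c₀) (hm0 : 0 ≤ m) (hmτ : m ≤ τ) :
    ∃ C : ℝ, 0 < C ∧ ∀ (N : ℕ), 8 ≤ N → 4 ∣ N →
      ∀ ε₁ : ℝ, ε₁ ∈ Set.Ioo (0 : ℝ) 1 →
        Real.sqrt ε₁ ≤ Real.sqrt c₀ * (N : ℝ)⁻¹ → Real.sqrt ε₁ ≤ 1 / 8 →
        ∀ j : ℕ, j ≤ N / 4 - 2 →
          ((τ / δ) * Real.sqrt ε₁ *
              (-Real.log (1 - 4 * (1 - Real.sqrt ε₁) * (((j : ℝ) + 1) / (N : ℝ)))) -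
            (τ / δ) * Real.sqrt ε₁ *
              (-Real.log (1 - 4 * (1 - Real.sqrt ε₁) * ((j : ℝ) / (N : ℝ))))) ^ m *
            Real.exp (-(δ * ((τ / δ) * Real.sqrt ε₁ *
              (-Real.log (1 - 4 * (1 - Real.sqrt ε₁) * ((j : ℝ) / (N : ℝ))))) /
                Real.sqrt ε₁)) ≤
          C * ε₁ ^ (m / 2) * (N : ℝ) ^ (-m) := by
  refine ⟨(8 * τ / δ) ^ m, by positivity, ?_⟩
  intro N hN h4 ε hε _ hs8 j hj
  have hN' : (8 : ℝ) ≤ N := by exact_mod_cast hN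
  have hNpos : (0 : ℝ) < N := by linarith
  have hjN : 4 * ((j : ℝ) + 2) ≤ N := by
    have : 4 * (j + 2) ≤ N := by omega
    exact_mod_cast this
  have hεm : ε ^ (m / 2) = (Real.sqrt ε) ^ m := by
    rw [Real.sqrt_eq_rpow, ← Real.rpow_mul hε.1.le]
    congr 1; ring
  rw [hεm]
  have hs : 0 < Real.sqrt ε := Real.sqrt_pos.2 hε.1
  set s := Real.sqrt ε with hsdef
  set a := 1 - 4 * (1 - s) * ((j : ℝ) / (N : ℝ)) with ha
  set b := 1 - 4 * (1 - s) * (((j : ℝ) + 1) / (N : ℝ)) with hb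
  have hj0 : (0 : ℝ) ≤ j := by positivity
  set q := 4 * (1 - s) / (N : ℝ) with hq
  have hqpos : 0 < q := by
    apply div_pos _ hNpos; linarith
  have hq4 : q ≤ 4 / N := by
    rw [hq]; gcongr; linarith
  have hab : a - b = q := by rw [ha, hb, hq]; ring
  have hqa : a = 1 - q * j := by rw [ha, hq]; ring
  have hqj : q * (j + 2) ≤ 1 - s := by
    have h1 : q * (j + 2) = (1 - s) * (4 * ((j : ℝ) + 2) / N) := by rw [hq]; ring
    rw [h1]
    have h2 : 4 * ((j : ℝ) + 2) / N ≤ 1 := (div_le_one hNpos).2 hjN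
    nlinarith
  have hbq : q ≤ b := by nlinarith
  have hbpos : 0 < b := by linarith
  have hapos : 0 < a := by linarith
  have ha1 : a ≤ 1 := by
    have : 0 ≤ q * j := by positivity
    linarith
  have hlog : Real.log a - Real.log b ≤ 8 / N / a := by
    rw [← Real.log_div hapos.ne' hbpos.ne']
    have h1 := Real.log_le_sub_one_of_pos (div_pos hapos hbpos)
    have h2 : a / b - 1 = q / b := by
      rw [← hab]; field_simp
    have h3 : q / b ≤ 8 / N / a := by
      rw [div_le_div_iff₀ hbpos hapos]
      have h5 : (8 : ℝ) / N = 2 * (4 / N) := by ring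
      have : q * a ≤ q * (2 * b) := by gcongr; linarith
      have : q * b ≤ 4 / N * b := by gcongr
      rw [h5]; linarith
    linarith
  have hlog0 : 0 ≤ Real.log a - Real.log b := by
    have := Real.log_le_log hbpos (by linarith : b ≤ a)
    linarith
  have hE : Real.exp (-(δ * (τ / δ * s * (-Real.log a)) / s)) ≤ a ^ m := by
    have h1 : -(δ * (τ / δ * s * (-Real.log a)) / s) = Real.log a * τ := by
      field_simp
    rw [h1, Real.rpow_def_of_pos hapos]
    apply Real.exp_le_exp.2
    exact mul_le_mul_of_nonpos_left hmτ (Real.log_nonpos hapos.le ha1)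
  have hW : (τ / δ * s * (-Real.log b) - τ / δ * s * (-Real.log a)) ^ m
      ≤ (8 * τ / δ * s * (N : ℝ)⁻¹ / a) ^ m := by
    have h1 : τ / δ * s * (-Real.log b) - τ / δ * s * (-Real.log a)
      = τ / δ * s * (Real.log a - Real.log b) := by ring
    have h2 : 8 * τ / δ * s * (N : ℝ)⁻¹ / a = τ / δ * s * (8 / N / a) := by ring
    rw [h1, h2]
    apply Real.rpow_le_rpow (by positivity) _ hm0
    gcongr
  calc _ ≤ (8 * τ / δ * s * (N : ℝ)⁻¹ / a) ^ m * a ^ m := by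
        gcongr
    _ = (8 * τ / δ * s * (N : ℝ)⁻¹) ^ m := by
        rw [← Real.mul_rpow (by positivity) hapos.le, div_mul_cancel₀ _ hapos.ne']
    _ = _ := by
        rw [Real.mul_rpow (by positivity) (by positivity), Real.mul_rpow (by positivity) hs.le,
          Real.rpow_neg hNpos.le, Real.inv_rpow hNpos.le]
end

section
/- Let τ > 0, p ∈ (0,1), and let η ∈ (0,1] be fixed. Then for every integer N ≥ 8 divisible by 4 and every μ₁ ≥ N, the Bakhvalov-type x-mesh width at the right transition point satisfies h_{x,3N/4} = (τ/(p μ₁)) ln(1 + 4(μ₁ − 1)/N) ≤ (τ/p)(ln 5 + η⁻¹) · μ₁^{η−1} N^{−η}; in particular h_{x,3N/4} ≤ C μ₁^{η−1} N^{−η} with C depending only on τ, p, η. -/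
/-- Let τ > 0, p ∈ (0,1), and let η ∈ (0,1] be fixed. Then for every integer
N ≥ 8 divisible by 4 and every μ₁ ≥ N, the Bakhvalov-type x-mesh width at the
right transition point satisfies
h_{x,3N/4} = (τ/(p μ₁)) ln(1 + 4(μ₁ − 1)/N) ≤ (τ/p)(ln 5 + η⁻¹) μ₁^{η−1} N^{−η};
in particular h_{x,3N/4} ≤ C μ₁^{η−1} N^{−η} with C depending only on τ, p, η. -/
theorem transition_width_refined_bound (τ p η : ℝ)
    (hτ : 0 < τ) (hp0 : 0 < p) (hp1 : p < 1) (hη : η ∈ Set.Ioc (0 : ℝ) 1) :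
    (∀ (N : ℕ), 8 ≤ N → 4 ∣ N → ∀ μ₁ : ℝ, (N : ℝ) ≤ μ₁ →
      (τ / (p * μ₁)) * Real.log (1 + 4 * (μ₁ - 1) / (N : ℝ)) ≤
        (τ / p) * (Real.log 5 + η⁻¹) * μ₁ ^ (η - 1) * (N : ℝ) ^ (-η)) ∧
    ∃ C : ℝ, 0 < C ∧ ∀ (N : ℕ), 8 ≤ N → 4 ∣ N → ∀ μ₁ : ℝ, (N : ℝ) ≤ μ₁ →
      (τ / (p * μ₁)) * Real.log (1 + 4 * (μ₁ - 1) / (N : ℝ)) ≤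
        C * μ₁ ^ (η - 1) * (N : ℝ) ^ (-η) := by
  obtain ⟨h0, h1⟩ := hη
  have h5 : 0 < Real.log 5 := Real.log_pos (by norm_num)
  have main : ∀ (N : ℕ), 8 ≤ N → 4 ∣ N → ∀ μ₁ : ℝ, (N : ℝ) ≤ μ₁ →
      (τ / (p * μ₁)) * Real.log (1 + 4 * (μ₁ - 1) / (N : ℝ)) ≤
        (τ / p) * (Real.log 5 + η⁻¹) * μ₁ ^ (η - 1) * (N : ℝ) ^ (-η) := by
    intro N hN _ m hm
    have hN8 : (8 : ℝ) ≤ N := by exact_mod_cast hN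
    have hN0 : (0 : ℝ) < N := by linarith
    have hm0 : 0 < m := by linarith
    have ht1 : 1 ≤ m / N := by rw [le_div_iff₀ hN0]; linarith
    have ht0 : 0 < m / N := by linarith
    have hq : 0 ≤ 4 * (m - 1) / (N : ℝ) := div_nonneg (by linarith) hN0.le
    have hle : 1 + 4 * (m - 1) / (N : ℝ) ≤ 5 * (m / N) := by
      have e : 4 * (m - 1) / (N : ℝ) ≤ 4 * (m / N) := by
        rw [← mul_div_assoc]
        gcongr
        linarith
      linarith
    have hlog : Real.log (1 + 4 * (m - 1) / (N : ℝ)) ≤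
        (Real.log 5 + η⁻¹) * (m / N) ^ η := by
      have a1 := Real.log_le_log (by linarith) hle
      rw [Real.log_mul (by norm_num) ht0.ne'] at a1
      have a2 := Real.log_le_rpow_div ht0.le h0
      have a3 : 1 ≤ (m / N) ^ η := Real.one_le_rpow ht1 h0.le
      rw [div_eq_mul_inv _ η] at a2
      nlinarith
    have hr : (τ / p) * (Real.log 5 + η⁻¹) * m ^ (η - 1) * (N : ℝ) ^ (-η) =
        (τ / (p * m)) * ((Real.log 5 + η⁻¹) * (m / N) ^ η) := by
      rw [Real.rpow_sub_one hm0.ne', Real.rpow_neg hN0.le, Real.div_rpow hm0.le hN0.le]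
      have : (N : ℝ) ^ η ≠ 0 := (Real.rpow_pos_of_pos hN0 η).ne'
      field_simp
    rw [hr]
    exact mul_le_mul_of_nonneg_left hlog (by positivity)
  exact ⟨main, (τ / p) * (Real.log 5 + η⁻¹), by positivity, main⟩
end
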